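/- Let 𝔤_1 and 𝔤_2 be nonzero finite-dimensional semisimple Lie algebras over an algebraically closed field K of characteristic 0, and for i = 1,2 let V_i be an irreducible 𝔤_i-module with dim_K V_i = r_i ≥ 2. Regard V := V_1 ⊗ V_2 as a module over 𝔤 := 𝔤_1 ⊕ 𝔤_2 via (x_1, x_2)·(v_1 ⊗ v_2) = (x_1 v_1) ⊗ v_2 + v_1 ⊗ (x_2 v_2), and set r := r_1 r_2. Then dim_K (V^{⊗r})^𝔤 ≥ 4. -/

import Mathlib

open scoped TensorProduct

/-- The action of an element `(x₁, x₂)` of the direct sum `𝔤₁ ⊕ 𝔤₂` on `V₁ ⊗ V₂`, given by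
`(x₁, x₂) · (v₁ ⊗ v₂) = (x₁ v₁) ⊗ v₂ + v₁ ⊗ (x₂ v₂)`. -/
noncomputable def prodTensorAction (K : Type*) [CommRing K]
    (𝔤₁ : Type*) [LieRing 𝔤₁] [LieAlgebra K 𝔤₁]
    (𝔤₂ : Type*) [LieRing 𝔤₂] [LieAlgebra K 𝔤₂]
    (V₁ : Type*) [AddCommGroup V₁] [Module K V₁] [LieRingModule 𝔤₁ V₁] [LieModule K 𝔤₁ V₁]
    (V₂ : Type*) [AddCommGroup V₂] [Module K V₂] [LieRingModule 𝔤₂ V₂] [LieModule K 𝔤₂ V₂]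
    (x : 𝔤₁ × 𝔤₂) : Module.End K (V₁ ⊗[K] V₂) :=
  TensorProduct.map (LieModule.toEnd K 𝔤₁ V₁ x.1) LinearMap.id +
    TensorProduct.map LinearMap.id (LieModule.toEnd K 𝔤₂ V₂ x.2)

/-- The derivation action of `(x₁, x₂) ∈ 𝔤₁ ⊕ 𝔤₂` on the `n`-fold tensor power
`(V₁ ⊗ V₂)^{⊗n}`. -/
noncomputable def prodTensorPowerAction (K : Type*) [CommRing K]
    (𝔤₁ : Type*) [LieRing 𝔤₁] [LieAlgebra K 𝔤₁]
    (𝔤₂ : Type*) [LieRing 𝔤₂] [LieAlgebra K 𝔤₂]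
    (V₁ : Type*) [AddCommGroup V₁] [Module K V₁] [LieRingModule 𝔤₁ V₁] [LieModule K 𝔤₁ V₁]
    (V₂ : Type*) [AddCommGroup V₂] [Module K V₂] [LieRingModule 𝔤₂ V₂] [LieModule K 𝔤₂ V₂]
    (n : ℕ) (x : 𝔤₁ × 𝔤₂) : Module.End K (⨂[K]^n (V₁ ⊗[K] V₂)) :=
  ∑ i : Fin n, PiTensorProduct.map
    (Function.update (fun _ : Fin n => (LinearMap.id : V₁ ⊗[K] V₂ →ₗ[K] V₁ ⊗[K] V₂)) i
      (prodTensorAction K 𝔤₁ 𝔤₂ V₁ V₂ x))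

/-- The subspace `((V₁ ⊗ V₂)^{⊗n})^{𝔤₁ ⊕ 𝔤₂}` of invariants. -/
noncomputable def prodTensorPowerInvariants (K : Type*) [CommRing K]
    (𝔤₁ : Type*) [LieRing 𝔤₁] [LieAlgebra K 𝔤₁]
    (𝔤₂ : Type*) [LieRing 𝔤₂] [LieAlgebra K 𝔤₂]
    (V₁ : Type*) [AddCommGroup V₁] [Module K V₁] [LieRingModule 𝔤₁ V₁] [LieModule K 𝔤₁ V₁]
    (V₂ : Type*) [AddCommGroup V₂] [Module K V₂] [LieRingModule 𝔤₂ V₂] [LieModule K 𝔤₂ V₂]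
    (n : ℕ) : Submodule K (⨂[K]^n (V₁ ⊗[K] V₂)) :=
  ⨅ x : 𝔤₁ × 𝔤₂, LinearMap.ker (prodTensorPowerAction K 𝔤₁ 𝔤₂ V₁ V₂ n x)

namespace LieAlgebra.IsSemisimple

theorem lie_top_top_eq_top {R L : Type*} [CommRing R] [LieRing L] [LieAlgebra R L]
    [IsSemisimple R L] : ⁅(⊤ : LieIdeal R L), (⊤ : LieIdeal R L)⁆ = ⊤ := by
  rw [eq_top_iff]
  nth_rewrite 1 [← sSup_atoms_eq_top (R := R) (L := L)]
  refine sSup_le fun I hI => ?_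
  rw [← lie_eq_self_of_isAtom_of_nonabelian I hI (non_abelian_of_isAtom I hI)]
  exact LieSubmodule.mono_lie le_top le_top

theorem trace_toEnd_eq_zero {R L : Type*} [CommRing R] [LieRing L] [LieAlgebra R L]
    [IsSemisimple R L] (M : Type*) [AddCommGroup M] [Module R M] [LieRingModule L M]
    [LieModule R L M] (x : L) : LinearMap.trace R M (LieModule.toEnd R L M x) = 0 := by
  refine LieModule.trace_toEnd_eq_zero_of_mem_lcs R L M le_rfl ?_
  rw [LieModule.lowerCentralSeries_succ, LieModule.lowerCentralSeries_zero, lie_top_top_eq_top]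
  exact LieSubmodule.mem_top x

end LieAlgebra.IsSemisimple

section BlockDet

variable (K : Type*) [CommRing K] {n κ ι : Type*} [Fintype κ] [DecidableEq κ] [Fintype ι]
  [DecidableEq ι]

/-- The coordinates of the tensor obtained by placing a determinant tensor
`∑ σ, sgn σ • (b_{σ 1} ⊗ ⋯ ⊗ b_{σ a})` in each of the blocks of tensor positions
`e.symm (k, ·)`. -/
def blockDet (e : n ≃ κ × ι) (x : n → ι) : K :=
  ∏ k, ((1 : Matrix ι ι K).submatrix (fun i => x (e.symm (k, i))) id).det

variable {K}

theorem blockDet_update [DecidableEq n] (e : n ≃ κ × ι) (x : n → ι) (k : κ) (p y : ι) :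
    blockDet K e (Function.update x (e.symm (k, p)) y) =
      (∏ l ∈ Finset.univ.erase k,
        ((1 : Matrix ι ι K).submatrix (fun i => x (e.symm (l, i))) id).det) *
      ((1 : Matrix ι ι K).submatrix (fun i => x (e.symm (k, i))) id).adjugate y p := by
  rw [blockDet, ← Finset.prod_erase_mul _ _ (Finset.mem_univ k), Matrix.adjugate_apply]
  congr 1
  · refine Finset.prod_congr rfl fun l hl => ?_
    congr 2
    funext i
    rw [Function.update_of_ne]
    simpa using fun h => absurd h (Finset.ne_of_mem_erase hl)
  · congr 1
    ext i j
    by_cases h : i = p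
    · subst h
      simp [Matrix.one_apply, Pi.single_apply, eq_comm]
    · have : Function.update x (e.symm (k, p)) y (e.symm (k, i)) = x (e.symm (k, i)) :=
        Function.update_of_ne (by simpa using h) _ _
      rw [Matrix.updateRow_ne h, Matrix.submatrix_apply, Matrix.submatrix_apply, this]

theorem sum_mul_blockDet_update [Fintype n] [DecidableEq n] (e : n ≃ κ × ι) (x : n → ι)
    (A : Matrix ι ι K) :
    ∑ i, ∑ y, A (x i) y * blockDet K e (Function.update x i y) =
      Fintype.card κ * A.trace * blockDet K e x := by
  rw [← e.symm.sum_comp, Fintype.sum_prod_type]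
  have key (k : κ) : ∑ p, ∑ y, A (x (e.symm (k, p))) y *
      blockDet K e (Function.update x (e.symm (k, p)) y) = A.trace * blockDet K e x := by
    set M := (1 : Matrix ι ι K).submatrix (fun i => x (e.symm (k, i))) id with hM
    have hA (p y : ι) : A (x (e.symm (k, p))) y = (M * A) p y := by
      simp [hM, Matrix.mul_apply, Matrix.one_apply]
    have htr : ∑ p, ∑ y, (M * A) p y * M.adjugate y p = M.det * A.trace := by
      have : (M * A * M.adjugate).trace = M.det * A.trace := by
        rw [Matrix.trace_mul_comm, ← Matrix.mul_assoc, Matrix.adjugate_mul]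
        simp
      rw [← this]
      exact Finset.sum_congr rfl fun _ _ => (Matrix.mul_apply ..).symm
    simp_rw [blockDet_update, hA, mul_left_comm, ← Finset.mul_sum]
    rw [← hM, htr, blockDet, ← Finset.prod_erase_mul _ _ (Finset.mem_univ k)]
    ring
  simp [key, mul_assoc]

theorem exists_blockDet_biorthogonal [Nontrivial κ] [Nontrivial ι] (e : n ≃ κ × ι) :
    ∃ f : Bool → (n ≃ κ × ι), ∀ s t,
      blockDet K (f s) (fun i => (f t i).2) = if s = t then 1 else 0 := by
  obtain ⟨k, l, hkl⟩ := exists_pair_ne κ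
  obtain ⟨p, q, hpq⟩ := exists_pair_ne ι
  have hself (g : n ≃ κ × ι) : blockDet K g (fun i => (g i).2) = 1 := by
    simp only [blockDet, Equiv.apply_symm_apply]
    exact Finset.prod_eq_one fun _ _ => Matrix.det_one
  have hswap : ∏ m : κ, ((1 : Matrix ι ι K).submatrix
      (fun i => (Equiv.swap (k, p) (l, q) (m, i)).2) id).det = 0 := by
    refine Finset.prod_eq_zero (Finset.mem_univ k) (Matrix.det_zero_of_row_eq hpq ?_)
    ext j
    have : Equiv.swap (k, p) (l, q) (k, q) = (k, q) :=
      Equiv.swap_apply_of_ne_of_ne (by simp [hpq.symm]) (by simp [hkl])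
    rw [Matrix.submatrix_apply, Matrix.submatrix_apply, Equiv.swap_apply_left, this]
  refine ⟨fun s => if s then e else e.trans (Equiv.swap (k, p) (l, q)), ?_⟩
  rintro (_ | _) (_ | _)
  · exact hself _
  · simpa [blockDet] using hswap
  · simpa [blockDet] using hswap
  · exact hself _

end BlockDet

theorem sum_map_update_equivFun_symm_eq_zero {K V n ι : Type*} [CommRing K] [AddCommGroup V]
    [Module K V] [Fintype n] [DecidableEq n] [Fintype ι] [DecidableEq ι] (b : Module.Basis ι K V)
    (A : Module.End K V) (c : (n → ι) → K)
    (hc : ∀ x, ∑ i, ∑ y, LinearMap.toMatrix b b A (x i) y * c (Function.update x i y) = 0) :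
    (∑ i, PiTensorProduct.map (Function.update (fun _ : n => (LinearMap.id : V →ₗ[K] V)) i A))
      ((Basis.piTensorProduct fun _ : n => b).equivFun.symm c) = 0 := by
  have hA (j : ι) : A (b j) = ∑ y, LinearMap.toMatrix b b A y j • b y := by
    simp [LinearMap.toMatrix_apply, b.sum_repr]
  have hmap (i : n) (x : n → ι) :
      PiTensorProduct.map (Function.update (fun _ : n => (LinearMap.id : V →ₗ[K] V)) i A)
        (PiTensorProduct.tprod K fun j => b (x j)) =
      ∑ y, LinearMap.toMatrix b b A y (x i) •
        PiTensorProduct.tprod K (fun j => b (Function.update x i y j)) := by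
    have h1 : (fun j => Function.update (fun _ : n => (LinearMap.id : V →ₗ[K] V)) i A j (b (x j))) =
        Function.update (fun j => b (x j)) i (A (b (x i))) := by
      ext j
      by_cases h : j = i
      · subst h; simp
      · simp [h]
    have h2 (y : ι) : (fun j => b (Function.update x i y j)) =
        Function.update (fun j => b (x j)) i (b y) := by
      ext j
      by_cases h : j = i
      · subst h; simp
      · simp [h]
    simp only [PiTensorProduct.map_tprod, h1, h2, hA, MultilinearMap.map_update_sum,
      MultilinearMap.map_update_smul]
  have hswap (i : n) :
      ∑ x : n → ι, ∑ y, (c x * LinearMap.toMatrix b b A y (x i)) •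
        PiTensorProduct.tprod K (fun j => b (Function.update x i y j)) =
      ∑ x : n → ι, ∑ y, (LinearMap.toMatrix b b A (x i) y * c (Function.update x i y)) •
        PiTensorProduct.tprod K (fun j => b (x j)) := by
    simp_rw [← Fintype.sum_prod_type']
    refine Finset.sum_nbij' (fun z => (Function.update z.1 i z.2, z.1 i))
      (fun z => (Function.update z.1 i z.2, z.1 i)) ?_ ?_ ?_ ?_ ?_ <;>
      simp [mul_comm]
  simp only [Module.Basis.equivFun_symm_apply, Basis.piTensorProduct_apply, LinearMap.sum_apply,
    map_sum, map_smul, hmap, Finset.smul_sum, smul_smul]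
  rw [Finset.sum_comm]
  simp only [hswap]
  rw [Finset.sum_comm]
  simp only [← Finset.sum_smul, hc, zero_smul, Finset.sum_const_zero]

section Invariants

variable {K : Type*} [Field K]
    {𝔤₁ : Type*} [LieRing 𝔤₁] [LieAlgebra K 𝔤₁]
    {𝔤₂ : Type*} [LieRing 𝔤₂] [LieAlgebra K 𝔤₂]
    {V₁ : Type*} [AddCommGroup V₁] [Module K V₁] [LieRingModule 𝔤₁ V₁] [LieModule K 𝔤₁ V₁]
    {V₂ : Type*} [AddCommGroup V₂] [Module K V₂] [LieRingModule 𝔤₂ V₂] [LieModule K 𝔤₂ V₂]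
    {ι₁ ι₂ : Type*} [Fintype ι₁] [Fintype ι₂] [DecidableEq ι₁] [DecidableEq ι₂]

theorem toMatrix_prodTensorAction (b₁ : Module.Basis ι₁ K V₁) (b₂ : Module.Basis ι₂ K V₂)
    (g : 𝔤₁ × 𝔤₂) (p q : ι₁ × ι₂) :
    LinearMap.toMatrix (b₁.tensorProduct b₂) (b₁.tensorProduct b₂)
        (prodTensorAction K 𝔤₁ 𝔤₂ V₁ V₂ g) p q =
      LinearMap.toMatrix b₁ b₁ (LieModule.toEnd K 𝔤₁ V₁ g.1) p.1 q.1 *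
          (1 : Matrix ι₂ ι₂ K) p.2 q.2 +
        (1 : Matrix ι₁ ι₁ K) p.1 q.1 *
          LinearMap.toMatrix b₂ b₂ (LieModule.toEnd K 𝔤₂ V₂ g.2) p.2 q.2 := by
  rw [prodTensorAction, map_add, TensorProduct.toMatrix_map, TensorProduct.toMatrix_map,
    LinearMap.toMatrix_id, LinearMap.toMatrix_id]
  rfl

theorem equivFun_symm_mem_prodTensorPowerInvariants [LieAlgebra.IsSemisimple K 𝔤₁]
    [LieAlgebra.IsSemisimple K 𝔤₂] {κ₁ κ₂ : Type*} [Fintype κ₁] [Fintype κ₂] [DecidableEq κ₁]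
    [DecidableEq κ₂] (b₁ : Module.Basis ι₁ K V₁) (b₂ : Module.Basis ι₂ K V₂) {n : ℕ}
    (e₁ : Fin n ≃ κ₁ × ι₁) (e₂ : Fin n ≃ κ₂ × ι₂) :
    (Basis.piTensorProduct fun _ : Fin n => b₁.tensorProduct b₂).equivFun.symm
        (fun x => blockDet K e₁ (fun i => (x i).1) * blockDet K e₂ (fun i => (x i).2)) ∈
      prodTensorPowerInvariants K 𝔤₁ 𝔤₂ V₁ V₂ n := by
  refine (Submodule.mem_iInf _).2 fun g => ?_
  refine sum_map_update_equivFun_symm_eq_zero _ _ _ fun x => ?_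
  have h₁ := sum_mul_blockDet_update e₁ (fun i => (x i).1)
    (LinearMap.toMatrix b₁ b₁ (LieModule.toEnd K 𝔤₁ V₁ g.1))
  have h₂ := sum_mul_blockDet_update e₂ (fun i => (x i).2)
    (LinearMap.toMatrix b₂ b₂ (LieModule.toEnd K 𝔤₂ V₂ g.2))
  rw [← LinearMap.trace_eq_matrix_trace, LieAlgebra.IsSemisimple.trace_toEnd_eq_zero] at h₁ h₂
  have hfst (i : Fin n) (y : ι₁ × ι₂) : (fun j => (Function.update x i y j).1) =
      Function.update (fun j => (x j).1) i y.1 := by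
    ext j
    by_cases h : j = i
    · subst h; simp
    · simp [h]
  have hsnd (i : Fin n) (y : ι₁ × ι₂) : (fun j => (Function.update x i y j).2) =
      Function.update (fun j => (x j).2) i y.2 := by
    ext j
    by_cases h : j = i
    · subst h; simp
    · simp [h]
  simp only [toMatrix_prodTensorAction, hfst, hsnd, add_mul, Finset.sum_add_distrib,
    Fintype.sum_prod_type]
  have t₁ : ∑ i, ∑ y, ∑ z, LinearMap.toMatrix b₁ b₁ (LieModule.toEnd K 𝔤₁ V₁ g.1) (x i).1 y *
        (1 : Matrix ι₂ ι₂ K) (x i).2 z *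
        (blockDet K e₁ (Function.update (fun j => (x j).1) i y) *
          blockDet K e₂ (Function.update (fun j => (x j).2) i z)) = 0 := by
    simp [Matrix.one_apply, ← mul_assoc, ← Finset.sum_mul, h₁]
  have t₂ : ∑ i, ∑ y, ∑ z, (1 : Matrix ι₁ ι₁ K) (x i).1 y *
        LinearMap.toMatrix b₂ b₂ (LieModule.toEnd K 𝔤₂ V₂ g.2) (x i).2 z *
        (blockDet K e₁ (Function.update (fun j => (x j).1) i y) *
          blockDet K e₂ (Function.update (fun j => (x j).2) i z)) = 0 := by
    simp_rw [Finset.sum_comm (s := (Finset.univ : Finset ι₁))]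
    simp [Matrix.one_apply, mul_left_comm, ← Finset.mul_sum, h₂]
  rw [t₁, t₂, add_zero]

end Invariants

/-- Let `𝔤₁` and `𝔤₂` be nonzero finite-dimensional semisimple Lie algebras
over an algebraically closed field `K` of characteristic `0`, and for `i = 1,2` let `Vᵢ` be an
irreducible `𝔤ᵢ`-module with `dim_K Vᵢ = rᵢ ≥ 2`. Regard `V := V₁ ⊗ V₂` as a module over
`𝔤 := 𝔤₁ ⊕ 𝔤₂` in the natural way, and set `r := r₁r₂`.
Then `dim_K (V^{⊗r})^𝔤 ≥ 4`. -/
theorem four_le_finrank_invariants_tensorPower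
    (K : Type*) [Field K] [IsAlgClosed K] [CharZero K]
    (𝔤₁ : Type*) [LieRing 𝔤₁] [LieAlgebra K 𝔤₁] [FiniteDimensional K 𝔤₁] [Nontrivial 𝔤₁]
    [LieAlgebra.IsSemisimple K 𝔤₁]
    (𝔤₂ : Type*) [LieRing 𝔤₂] [LieAlgebra K 𝔤₂] [FiniteDimensional K 𝔤₂] [Nontrivial 𝔤₂]
    [LieAlgebra.IsSemisimple K 𝔤₂]
    (V₁ : Type*) [AddCommGroup V₁] [Module K V₁] [LieRingModule 𝔤₁ V₁] [LieModule K 𝔤₁ V₁]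
    [FiniteDimensional K V₁] [LieModule.IsIrreducible K 𝔤₁ V₁]
    (V₂ : Type*) [AddCommGroup V₂] [Module K V₂] [LieRingModule 𝔤₂ V₂] [LieModule K 𝔤₂ V₂]
    [FiniteDimensional K V₂] [LieModule.IsIrreducible K 𝔤₂ V₂]
    (r₁ r₂ : ℕ) (hr₁ : r₁ = Module.finrank K V₁) (hr₂ : r₂ = Module.finrank K V₂)
    (hr₁2 : 2 ≤ r₁) (hr₂2 : 2 ≤ r₂) :
    4 ≤ Module.finrank K (prodTensorPowerInvariants K 𝔤₁ 𝔤₂ V₁ V₂ (r₁ * r₂)) := by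
  subst hr₁ hr₂
  have : Nontrivial (Fin (Module.finrank K V₁)) := Fin.nontrivial_iff_two_le.2 hr₁2
  have : Nontrivial (Fin (Module.finrank K V₂)) := Fin.nontrivial_iff_two_le.2 hr₂2
  let b₁ := Module.finBasis K V₁
  let b₂ := Module.finBasis K V₂
  obtain ⟨f₁, hf₁⟩ := exists_blockDet_biorthogonal (K := K)
    ((finProdFinEquiv (m := Module.finrank K V₁) (n := Module.finrank K V₂)).symm.trans
      (Equiv.prodComm _ _))
  obtain ⟨f₂, hf₂⟩ := exists_blockDet_biorthogonal (K := K)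
    (finProdFinEquiv (m := Module.finrank K V₁) (n := Module.finrank K V₂)).symm
  let B := Basis.piTensorProduct
    fun _ : Fin (Module.finrank K V₁ * Module.finrank K V₂) => b₁.tensorProduct b₂
  have : Module.Finite K (⨂[K]^(Module.finrank K V₁ * Module.finrank K V₂) (V₁ ⊗[K] V₂)) :=
    Module.Finite.of_basis B
  let w (s : Bool × Bool) : prodTensorPowerInvariants K 𝔤₁ 𝔤₂ V₁ V₂
      (Module.finrank K V₁ * Module.finrank K V₂) :=
    ⟨_, equivFun_symm_mem_prodTensorPowerInvariants b₁ b₂ (f₁ s.1) (f₂ s.2)⟩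
  have hw (s t : Bool × Bool) : B.equivFun (w s : ⨂[K]^_ (V₁ ⊗[K] V₂))
      (fun i => ((f₁ t.1 i).2, (f₂ t.2 i).2)) = if s = t then 1 else 0 := by
    simp only [w, B, LinearEquiv.apply_symm_apply, hf₁, hf₂, ite_zero_mul_ite_zero, mul_one,
      Prod.ext_iff]
  have hli : LinearIndependent K w := by
    rw [Fintype.linearIndependent_iffₛ]
    intro a c h t
    have := congrArg (fun v => B.equivFun (Subtype.val v)
      (fun i => ((f₁ t.1 i).2, (f₂ t.2 i).2))) h
    simpa only [Submodule.coe_sum, Submodule.coe_smul, map_sum, map_smul, Finset.sum_apply,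
      Pi.smul_apply, hw, smul_eq_mul, mul_ite, mul_one, mul_zero, Finset.sum_ite_eq',
      Finset.mem_univ, if_true] using this
  simpa using hli.fintype_card_le_finrank
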